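/- Let p be an odd prime, G a powerful p-group, and i a natural number. If N is a normal subgroup of G^{p^i} with N ≤ G^{p^{i+1}}, then N is powerfully nilpotent. -/

import Mathlib

/-- For a subgroup `H` of `G`, the subgroup generated by `n`-th powers of elements of `H`. -/
def sgPow {G : Type*} [Group G] (H : Subgroup G) (n : ℕ) : Subgroup G :=
  Subgroup.closure {x | ∃ h ∈ H, h ^ n = x}

/-- `N` is powerfully nilpotent (w.r.t. the prime `p`): there is an ascending chain of
subgroups `⊥ = H 0 ≤ H 1 ≤ ⋯ ≤ H n = N` with `[H (i+1), N] ≤ (H i)^p`. -/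
def PowerfullyNilpotentOn {G : Type*} [Group G] (p : ℕ) (N : Subgroup G) : Prop :=
  ∃ (n : ℕ) (H : ℕ → Subgroup G), H 0 = ⊥ ∧ H n = N ∧ (∀ i, H i ≤ H (i + 1)) ∧
    (∀ i, H i ≤ N) ∧ ∀ i < n, ⁅H (i + 1), N⁆ ≤ sgPow (H i) p

section CommutatorIdentities

open scoped commutatorElement

variable {G : Type*} [Group G]

theorem pow_conj_eq_of_commute {x y c d : G} (hc : y * x * y⁻¹ = c * x)
    (hd : y * c * y⁻¹ = d * c) (hdc : Commute d c) (hdy : Commute d y) (n : ℕ) :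
    y ^ n * x * (y ^ n)⁻¹ = d ^ n.choose 2 * c ^ n * x := by
  induction n with
  | zero => simp
  | succ n ih =>
    have hcn : y * c ^ n * y⁻¹ = d ^ n * c ^ n := by
      rw [← conj_pow, hd, hdc.mul_pow]
    have hdn : y * d ^ n.choose 2 * y⁻¹ = d ^ n.choose 2 := by
      rw [(hdy.symm.pow_right _).eq, mul_inv_cancel_right]
    calc y ^ (n + 1) * x * (y ^ (n + 1))⁻¹
        = y * (y ^ n * x * (y ^ n)⁻¹) * y⁻¹ := by rw [pow_succ']; group
      _ = (y * d ^ n.choose 2 * y⁻¹) * (y * c ^ n * y⁻¹) * (y * x * y⁻¹) := by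
          rw [ih]; group
      _ = d ^ (n.choose 2 + n) * c ^ (n + 1) * x := by
          rw [hcn, hdn, hc, pow_add, pow_succ c]; group
      _ = _ := by
          rw [Nat.choose_succ_succ' n 1, Nat.choose_one_right, Nat.add_comm (n.choose 2)]

theorem commutatorElement_pow_left_of_commute {x y : G}
    (h₁ : Commute ⁅y, ⁅y, x⁆⁆ ⁅y, x⁆) (h₂ : Commute ⁅y, ⁅y, x⁆⁆ y) (n : ℕ) :
    ⁅y ^ n, x⁆ = ⁅y, ⁅y, x⁆⁆ ^ n.choose 2 * ⁅y, x⁆ ^ n := by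
  have := pow_conj_eq_of_commute (x := x) (y := y) (c := ⁅y, x⁆) (d := ⁅y, ⁅y, x⁆⁆)
    (by simp [commutatorElement_def])
    (by rw [commutatorElement_def y ⁅y, x⁆, inv_mul_cancel_right]) h₁ h₂ n
  rw [commutatorElement_def (y ^ n), this, mul_inv_cancel_right]

theorem mul_pow_of_commute_commutatorElement {x y : G}
    (hx : Commute ⁅y, x⁆ x) (hy : Commute ⁅y, x⁆ y) (n : ℕ) :
    (x * y) ^ n = x ^ n * y ^ n * ⁅y, x⁆ ^ n.choose 2 := by
  have key (n : ℕ) : y ^ n * x = ⁅y, x⁆ ^ n * x * y ^ n := by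
    have := commutatorElement_pow_left_of_commute (x := x) (y := y)
      (by simp [hy.symm.commutator_eq]) (by simp [hy.symm.commutator_eq]) n
    rw [hy.symm.commutator_eq, one_pow, one_mul] at this
    rw [← this, commutatorElement_def]; group
  induction n with
  | zero => simp
  | succ n ih =>
    set c := ⁅y, x⁆
    calc (x * y) ^ (n + 1) = x ^ n * y ^ n * (c ^ n.choose 2 * (x * y)) := by
          rw [pow_succ, ih]; group
      _ = x ^ n * (y ^ n * x) * y * c ^ n.choose 2 := by
          rw [((hx.mul_right hy).pow_left _).eq]; group
      _ = x ^ n * (c ^ n * x * y ^ n) * y * c ^ n.choose 2 := by rw [key]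
      _ = x ^ n * (x * (y ^ n * y) * c ^ n) * c ^ n.choose 2 := by
          have h₁ : Commute (c ^ n) (x * (y ^ n * y)) :=
            (hx.mul_right ((hy.pow_right n).mul_right hy)).pow_left n
          rw [← h₁.eq]; group
      _ = x ^ (n + 1) * y ^ (n + 1) * c ^ (n + n.choose 2) := by
          rw [pow_succ x, pow_succ y, pow_add]; group
      _ = _ := by rw [Nat.choose_succ_succ' n 1, Nat.choose_one_right]

theorem Odd.dvd_choose_two {n : ℕ} (hn : Odd n) : n ∣ n.choose 2 := by
  obtain ⟨k, rfl⟩ := hn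
  refine ⟨k, ?_⟩
  rw [Nat.choose_two_right, Nat.add_sub_cancel, ← mul_assoc, mul_comm _ 2, mul_assoc,
    Nat.mul_div_cancel_left _ two_pos]

theorem pow_choose_two_eq_one {n : ℕ} (hn : Odd n) {d : G} (hd : d ^ n = 1) :
    d ^ n.choose 2 = 1 := by
  obtain ⟨k, hk⟩ := hn.dvd_choose_two
  rw [hk, pow_mul, hd, one_pow]

theorem QuotientGroup.commute_mk_iff {S : Subgroup G} [S.Normal] {a b : G} :
    Commute (a : G ⧸ S) (b : G ⧸ S) ↔ ⁅a, b⁆ ∈ S := by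
  rw [← commutatorElement_eq_one_iff_commute, ← QuotientGroup.eq_one_iff]
  rfl

theorem commutatorElement_pow_left_mul_inv_mem {n : ℕ} (hn : Odd n) {S : Subgroup G} [S.Normal]
    {x y : G} (h₁ : ⁅⁅y, ⁅y, x⁆⁆, ⁅y, x⁆⁆ ∈ S) (h₂ : ⁅⁅y, ⁅y, x⁆⁆, y⁆ ∈ S)
    (h₃ : ⁅y, ⁅y, x⁆⁆ ^ n ∈ S) : ⁅y ^ n, x⁆ * (⁅y, x⁆ ^ n)⁻¹ ∈ S := by
  rw [← QuotientGroup.commute_mk_iff] at h₁ h₂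
  rw [← QuotientGroup.eq_one_iff] at h₃ ⊢
  have := commutatorElement_pow_left_of_commute (x := (x : G ⧸ S)) (y := (y : G ⧸ S)) h₁ h₂ n
  rw [pow_choose_two_eq_one hn h₃, one_mul] at this
  exact mul_inv_eq_one.mpr this

theorem commutatorElement_pow_left_mem {n : ℕ} (hn : Odd n) {S : Subgroup G} [S.Normal]
    {x y : G} (h₁ : ⁅⁅y, ⁅y, x⁆⁆, ⁅y, x⁆⁆ ∈ S) (h₂ : ⁅⁅y, ⁅y, x⁆⁆, y⁆ ∈ S)
    (h₃ : ⁅y, ⁅y, x⁆⁆ ^ n ∈ S) (h₄ : ⁅y, x⁆ ^ n ∈ S) : ⁅y ^ n, x⁆ ∈ S :=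
  (S.mul_mem_cancel_right (S.inv_mem h₄)).mp (commutatorElement_pow_left_mul_inv_mem hn h₁ h₂ h₃)

/-- The elements of `G` which commute with every element of `T` modulo `R`. -/
def centralizerMod (R : Subgroup G) [R.Normal] (T : Subgroup G) : Subgroup G :=
  (Subgroup.centralizer (T.map (QuotientGroup.mk' R))).comap (QuotientGroup.mk' R)

theorem mem_centralizerMod {R : Subgroup G} [R.Normal] {T : Subgroup G} {g : G} :
    g ∈ centralizerMod R T ↔ ∀ t ∈ T, ⁅g, t⁆ ∈ R := by
  simp only [centralizerMod, Subgroup.mem_comap, Subgroup.mem_centralizer_iff]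
  constructor
  · intro h t ht
    rw [← QuotientGroup.commute_mk_iff]
    exact (h _ ⟨t, ht, rfl⟩).symm
  · rintro h _ ⟨t, ht, rfl⟩
    exact (QuotientGroup.commute_mk_iff.mpr (h t ht)).symm

instance centralizerMod_normal (R T : Subgroup G) [R.Normal] [T.Normal] :
    (centralizerMod R T).Normal := by
  have : (T.map (QuotientGroup.mk' R)).Normal :=
    Subgroup.Normal.map ‹_› _ (QuotientGroup.mk'_surjective R)
  unfold centralizerMod
  infer_instance

theorem le_of_le_sup_commutator_top [Group.IsNilpotent G] {A B : Subgroup G} [A.Normal] [B.Normal]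
    (h : A ≤ B ⊔ ⁅A, (⊤ : Subgroup G)⁆) : A ≤ B := by
  have key (n : ℕ) : A ≤ B ⊔ Subgroup.lowerCentralSeries (⊤ : Subgroup G) n := by
    induction n with
    | zero => simp
    | succ n ih =>
      refine h.trans (sup_le le_sup_left ?_)
      refine (Subgroup.commutator_mono ih le_rfl).trans (Subgroup.commutator_le.mpr ?_)
      intro g hg x _
      have : B ⊔ Subgroup.lowerCentralSeries (⊤ : Subgroup G) n ≤
          centralizerMod (B ⊔ Subgroup.lowerCentralSeries (⊤ : Subgroup G) (n + 1)) ⊤ := by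
        refine sup_le (fun b hb => ?_) (fun l hl => ?_)
        · exact mem_centralizerMod.mpr fun t _ => Subgroup.mem_sup_left
            (Subgroup.commutator_le_left B ⊤ (Subgroup.commutator_mem_commutator hb (Subgroup.mem_top _)))
        · exact mem_centralizerMod.mpr fun t _ => Subgroup.mem_sup_right
            (Subgroup.commutator_mem_commutator hl (Subgroup.mem_top _))
      exact mem_centralizerMod.mp (this hg) x trivial
  obtain ⟨n, hn⟩ := Subgroup.nilpotent_iff_lowerCentralSeries.mp ‹Group.IsNilpotent G›
  simpa [hn] using key n

end CommutatorIdentities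

section PowerSubgroups

open scoped commutatorElement

variable {G : Type*} [Group G]

theorem pow_mem_sgPow {H : Subgroup G} {x : G} (hx : x ∈ H) (n : ℕ) : x ^ n ∈ sgPow H n :=
  Subgroup.subset_closure ⟨x, hx, rfl⟩

theorem sgPow_le_iff {H K : Subgroup G} {n : ℕ} : sgPow H n ≤ K ↔ ∀ x ∈ H, x ^ n ∈ K := by
  rw [sgPow, Subgroup.closure_le]
  exact ⟨fun h x hx => h ⟨x, hx, rfl⟩, by rintro h _ ⟨x, hx, rfl⟩; exact h x hx⟩

theorem sgPow_le_self (H : Subgroup G) (n : ℕ) : sgPow H n ≤ H :=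
  sgPow_le_iff.mpr fun _ hx => H.pow_mem hx n

theorem sgPow_mono {H K : Subgroup G} (h : H ≤ K) (n : ℕ) : sgPow H n ≤ sgPow K n :=
  sgPow_le_iff.mpr fun _ hx => pow_mem_sgPow (h hx) n

theorem map_sgPow {G' : Type*} [Group G'] (f : G →* G') (H : Subgroup G) (n : ℕ) :
    (sgPow H n).map f = sgPow (H.map f) n := by
  apply le_antisymm
  · rw [Subgroup.map_le_iff_le_comap, sgPow_le_iff]
    intro x hx
    rw [Subgroup.mem_comap, map_pow]
    exact pow_mem_sgPow (Subgroup.mem_map_of_mem f hx) n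
  · rw [sgPow_le_iff]
    rintro _ ⟨x, hx, rfl⟩
    exact ⟨x ^ n, pow_mem_sgPow hx n, map_pow f x n⟩

instance sgPow_normal (H : Subgroup G) [hH : H.Normal] (n : ℕ) : (sgPow H n).Normal := by
  refine ⟨fun x hx g => ?_⟩
  have : sgPow H n ≤ (sgPow H n).comap (MulAut.conj g).toMonoidHom := by
    refine sgPow_le_iff.mpr fun y hy => ?_
    rw [Subgroup.mem_comap, map_pow]
    exact pow_mem_sgPow (hH.conj_mem y hy g) n
  exact this hx

/-- The series `G, G^p, (G^p)^p, …`. -/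
def powerSeriesSubgroup (G : Type*) [Group G] (p : ℕ) : ℕ → Subgroup G
  | 0 => ⊤
  | k + 1 => sgPow (powerSeriesSubgroup G p k) p

instance powerSeriesSubgroup_normal (p k : ℕ) : (powerSeriesSubgroup G p k).Normal := by
  induction k with
  | zero => exact inferInstanceAs (⊤ : Subgroup G).Normal
  | succ k _ => exact sgPow_normal _ p

theorem powerSeriesSubgroup_antitone (p : ℕ) : Antitone (powerSeriesSubgroup G p) :=
  antitone_nat_of_succ_le fun k => sgPow_le_self (powerSeriesSubgroup G p k) p

theorem map_powerSeriesSubgroup {G' : Type*} [Group G'] {f : G →* G'}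
    (hf : Function.Surjective f) (p k : ℕ) :
    (powerSeriesSubgroup G p k).map f = powerSeriesSubgroup G' p k := by
  induction k with
  | zero => exact Subgroup.map_top_of_surjective f hf
  | succ k ih => simp only [powerSeriesSubgroup, map_sgPow, ih]

theorem pow_pow_mem_powerSeriesSubgroup (p k : ℕ) (x : G) :
    x ^ p ^ k ∈ powerSeriesSubgroup G p k := by
  induction k with
  | zero => exact Subgroup.mem_top _
  | succ k ih => rw [pow_succ, pow_mul]; exact pow_mem_sgPow ih p

theorem commutator_le_of_forall_pow {N S : Subgroup G} [S.Normal] {n : ℕ}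
    (h : ∀ x ∈ N, ∀ g : G, ⁅x ^ n, g⁆ ∈ S) : ⁅sgPow N n, (⊤ : Subgroup G)⁆ ≤ S := by
  have : sgPow N n ≤ centralizerMod S ⊤ :=
    sgPow_le_iff.mpr fun x hx => mem_centralizerMod.mpr fun g _ => h x hx g
  exact Subgroup.commutator_le.mpr fun x hx g hg => mem_centralizerMod.mp (this hx) g hg

/-- If `[N, G] ≤ N^p`, then `[N^p, G] ≤ (N^p)^p`. -/
theorem commutator_sgPow_le [Group.IsNilpotent G] {p : ℕ} (hp : Odd p) {N : Subgroup G} [N.Normal]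
    (hN : ⁅N, (⊤ : Subgroup G)⁆ ≤ sgPow N p) :
    ⁅sgPow N p, (⊤ : Subgroup G)⁆ ≤ sgPow (sgPow N p) p := by
  refine le_of_le_sup_commutator_top (commutator_le_of_forall_pow fun x hx g => ?_)
  have hc : ⁅x, g⁆ ∈ sgPow N p :=
    hN (Subgroup.commutator_mem_commutator hx (Subgroup.mem_top g))
  have hd : ⁅x, ⁅x, g⁆⁆ ∈ ⁅sgPow N p, (⊤ : Subgroup G)⁆ := by
    rw [Subgroup.commutator_comm]
    exact Subgroup.commutator_mem_commutator (Subgroup.mem_top x) hc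
  have hd' : ⁅x, ⁅x, g⁆⁆ ∈ sgPow N p := Subgroup.commutator_le_left _ _ hd
  refine commutatorElement_pow_left_mem hp ?_ ?_ ?_ ?_
  · exact Subgroup.mem_sup_right (Subgroup.commutator_mem_commutator hd (Subgroup.mem_top _))
  · exact Subgroup.mem_sup_right (Subgroup.commutator_mem_commutator hd (Subgroup.mem_top _))
  · exact Subgroup.mem_sup_left (pow_mem_sgPow hd' p)
  · exact Subgroup.mem_sup_left (pow_mem_sgPow hc p)

end PowerSubgroups

section Powerful

open scoped commutatorElement

/-- A finite group of odd prime power order which satisfies `[G, G] ≤ G^p`. -/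
structure IsPowerfulPGroup (p : ℕ) (G : Type*) [Group G] : Prop where
  prime : p.Prime
  odd : Odd p
  isPGroup : IsPGroup p G
  commutator_le : ⁅(⊤ : Subgroup G), (⊤ : Subgroup G)⁆ ≤ sgPow ⊤ p

namespace IsPowerfulPGroup

variable {p : ℕ} {G : Type*} [Group G]

local notation "P" => powerSeriesSubgroup G p

theorem of_surjective (hG : IsPowerfulPGroup p G) {G' : Type*} [Group G'] {f : G →* G'}
    (hf : Function.Surjective f) : IsPowerfulPGroup p G' where
  prime := hG.prime
  odd := hG.odd
  isPGroup := hG.isPGroup.of_surjective f hf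
  commutator_le := by
    have := Subgroup.map_mono (f := f) hG.commutator_le
    rwa [Subgroup.map_commutator, map_sgPow, Subgroup.map_top_of_surjective f hf] at this

theorem subgroup (hG : IsPowerfulPGroup p G) {H : Subgroup G} (hH : ⁅H, H⁆ ≤ sgPow H p) :
    IsPowerfulPGroup p H where
  prime := hG.prime
  odd := hG.odd
  isPGroup := hG.isPGroup.to_subgroup H
  commutator_le := by
    rw [← Subgroup.map_subtype_le_map_subtype, Subgroup.map_commutator, map_sgPow,
      ← MonoidHom.range_eq_map, Subgroup.range_subtype]
    exact hH

theorem zpowers_sup_powerSeriesSubgroup_one_normal (hG : IsPowerfulPGroup p G) (a : G) :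
    (Subgroup.zpowers a ⊔ P 1).Normal :=
  Subgroup.commutator_top_right_le_iff.mp <|
    (Subgroup.commutator_mono le_top le_rfl).trans (hG.commutator_le.trans le_sup_right)

theorem exists_normal_torsion {H : Subgroup G} (hH : H.Normal)
    (h : ∀ x y : H, x ^ p = 1 → y ^ p = 1 → (x * y) ^ p = 1) :
    ∃ A : Subgroup G, A.Normal ∧ ∀ g, g ∈ A ↔ g ∈ H ∧ g ^ p = 1 := by
  refine ⟨{ carrier := {g | g ∈ H ∧ g ^ p = 1}
            mul_mem' := ?_
            one_mem' := ⟨H.one_mem, one_pow p⟩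
            inv_mem' := fun {x} hx => ⟨H.inv_mem hx.1, by rw [inv_pow, hx.2, inv_one]⟩ },
    ⟨fun g hg a => ⟨hH.conj_mem g hg.1 a, ?_⟩⟩, fun g => Iff.rfl⟩
  · rintro x y ⟨hx, hx'⟩ ⟨hy, hy'⟩
    refine ⟨H.mul_mem hx hy, ?_⟩
    simpa [Subtype.ext_iff] using h ⟨x, hx⟩ ⟨y, hy⟩ (by simpa [Subtype.ext_iff] using hx')
      (by simpa [Subtype.ext_iff] using hy')
  · rw [conj_pow, hg.2, mul_one, mul_inv_cancel]

variable [Finite G]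

theorem isNilpotent (hG : IsPowerfulPGroup p G) : Group.IsNilpotent G :=
  have : Fact p.Prime := ⟨hG.prime⟩
  hG.isPGroup.isNilpotent

theorem commutator_powerSeriesSubgroup_le (hG : IsPowerfulPGroup p G) (k : ℕ) :
    ⁅P k, (⊤ : Subgroup G)⁆ ≤ P (k + 1) := by
  have := hG.isNilpotent
  induction k with
  | zero => exact hG.commutator_le
  | succ k ih => exact commutator_sgPow_le hG.odd ih

theorem commutatorElement_mem_left (hG : IsPowerfulPGroup p G) {k : ℕ} {x : G} (hx : x ∈ P k)
    (y : G) : ⁅x, y⁆ ∈ P (k + 1) :=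
  hG.commutator_powerSeriesSubgroup_le k
    (Subgroup.commutator_mem_commutator hx (Subgroup.mem_top y))

theorem commutatorElement_mem_right (hG : IsPowerfulPGroup p G) {k : ℕ} {x : G} (hx : x ∈ P k)
    (y : G) : ⁅y, x⁆ ∈ P (k + 1) := by
  rw [← commutatorElement_inv]
  exact inv_mem (hG.commutatorElement_mem_left hx y)

theorem powerSeriesSubgroup_subgroup (hG : IsPowerfulPGroup p G) (k : ℕ) :
    IsPowerfulPGroup p (P k) :=
  hG.subgroup ((Subgroup.commutator_mono le_rfl le_top).trans
    (hG.commutator_powerSeriesSubgroup_le k))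

theorem zpowers_sup_powerSeriesSubgroup_one (hG : IsPowerfulPGroup p G) (a : G) :
    IsPowerfulPGroup p (Subgroup.zpowers a ⊔ P 1 : Subgroup G) := by
  refine hG.subgroup (le_trans (b := P 2) ?_ (sgPow_mono le_sup_right p))
  have h₁ (T : Subgroup G) : P 1 ≤ centralizerMod (P 2) T := fun x hx =>
    mem_centralizerMod.mpr fun t _ => hG.commutatorElement_mem_left hx t
  have h₂ : Subgroup.zpowers a ⊔ P 1 ≤ centralizerMod (P 2) (Subgroup.zpowers a) := by
    refine sup_le (Subgroup.zpowers_le.mpr (mem_centralizerMod.mpr ?_)) (h₁ _)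
    rintro _ ⟨n, rfl⟩
    rw [((Commute.refl a).zpow_right n).commutator_eq]
    exact one_mem _
  have h₃ : Subgroup.zpowers a ⊔ P 1 ≤
      centralizerMod (P 2) (Subgroup.zpowers a ⊔ P 1) := by
    refine sup_le (Subgroup.zpowers_le.mpr (mem_centralizerMod.mpr fun t ht => ?_)) (h₁ _)
    rw [← commutatorElement_inv]
    exact inv_mem (mem_centralizerMod.mp (h₂ ht) a (Subgroup.mem_zpowers a))
  exact Subgroup.commutator_le.mpr fun x hx y hy => mem_centralizerMod.mp (h₃ hx) y hy

theorem powerSeriesSubgroup_one_le_frattini (hG : IsPowerfulPGroup p G) : P 1 ≤ frattini G := by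
  have := hG.isNilpotent
  have hp : Fact p.Prime := ⟨hG.prime⟩
  refine le_iInf₂ fun K hK => sgPow_le_iff.mpr fun x _ => ?_
  have hKn : K.Normal :=
    Subgroup.NormalizerCondition.normal_of_coatom K Group.normalizerCondition_of_isNilpotent hK
  by_contra hx
  have hxK : K ⊔ Subgroup.zpowers (x ^ p) = ⊤ :=
    hK.2 _ (left_lt_sup.mpr fun h => hx (Subgroup.zpowers_le.mp h))
  have hmap : (Subgroup.zpowers (x ^ p)).map (QuotientGroup.mk' K) = ⊤ := by
    rw [← Subgroup.map_top_of_surjective _ (QuotientGroup.mk'_surjective K), ← hxK,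
      Subgroup.map_sup, QuotientGroup.map_mk'_self, bot_sup_eq]
  obtain ⟨_, ⟨n, rfl⟩, hn⟩ : (x : G ⧸ K) ∈ (Subgroup.zpowers (x ^ p)).map (QuotientGroup.mk' K) :=
    hmap ▸ Subgroup.mem_top _
  set y : G ⧸ K := (x : G ⧸ K)
  have hy : y ≠ 1 := fun h => hx (K.pow_mem ((QuotientGroup.eq_one_iff x).mp h) p)
  have hyp : p ∣ orderOf y := (hG.isPGroup.to_quotient K).dvd_orderOf hy
  have h₁ : (y ^ p) ^ n = y := hn
  have h₂ : y ^ ((p : ℤ) * n - 1) = 1 := by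
    rw [zpow_sub, zpow_mul, zpow_natCast, h₁, zpow_one, mul_inv_cancel]
  have h₃ : (p : ℤ) ∣ p * n - 1 :=
    (Int.natCast_dvd_natCast.mpr hyp).trans (orderOf_dvd_iff_zpow_eq_one.mpr h₂)
  have h₄ : (p : ℤ) ∣ 1 := (dvd_sub_right (dvd_mul_right _ _)).mp h₃
  exact hG.prime.one_lt.ne' (Nat.dvd_one.mp (by exact_mod_cast h₄))

theorem commute_of_zpowers_sup_eq_top (hG : IsPowerfulPGroup p G) {a : G}
    (h : Subgroup.zpowers a ⊔ P 1 = ⊤) (x y : G) : Commute x y := by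
  have ha : Subgroup.zpowers a = ⊤ := frattini_nongenerating
    (top_le_iff.mp (h.ge.trans (sup_le_sup_left hG.powerSeriesSubgroup_one_le_frattini _)))
  obtain ⟨m, rfl⟩ : x ∈ Subgroup.zpowers a := ha ▸ Subgroup.mem_top x
  obtain ⟨n, rfl⟩ : y ∈ Subgroup.zpowers a := ha ▸ Subgroup.mem_top y
  exact Commute.zpow_zpow_self a m n

theorem mul_pow_mem (hG : IsPowerfulPGroup p G) (x y : G) :
    (x ^ p * y ^ p)⁻¹ * (x * y) ^ p ∈ P 2 := by
  have hc : ⁅y, x⁆ ∈ P 1 := hG.commutatorElement_mem_left (k := 0) (Subgroup.mem_top y) x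
  have hx := QuotientGroup.commute_mk_iff.mpr (hG.commutatorElement_mem_left hc x)
  have hy := QuotientGroup.commute_mk_iff.mpr (hG.commutatorElement_mem_left hc y)
  have hcp : (⁅(y : G ⧸ P 2), (x : G ⧸ P 2)⁆) ^ p = 1 :=
    (QuotientGroup.eq_one_iff (⁅y, x⁆ ^ p)).mpr (pow_mem_sgPow hc p)
  have := mul_pow_of_commute_commutatorElement (x := (x : G ⧸ P 2)) (y := (y : G ⧸ P 2)) hx hy p
  rw [pow_choose_two_eq_one hG.odd hcp, mul_one] at this
  exact QuotientGroup.eq.mp this.symm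

theorem exists_pow_eq_of_card_le (n : ℕ) : ∀ (G : Type*) [Group G] [Finite G],
    IsPowerfulPGroup p G → Nat.card G ≤ n → ∀ g ∈ sgPow (⊤ : Subgroup G) p, ∃ x, x ^ p = g := by
  induction n with
  | zero => exact fun G _ _ _ h => absurd h Nat.card_pos.not_ge
  | succ n ih =>
    intro G _ _ hG hcard g hg
    obtain ⟨a, ha⟩ : ∃ a : G, (a ^ p)⁻¹ * g ∈ powerSeriesSubgroup G p 2 := by
      induction hg using Subgroup.closure_induction with
      | mem x hx =>
        obtain ⟨a, -, rfl⟩ := hx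
        exact ⟨a, by simp⟩
      | one => exact ⟨1, by simp⟩
      | mul x y _ _ hx hy =>
        obtain ⟨a, ha⟩ := hx
        obtain ⟨b, hb⟩ := hy
        refine ⟨a * b, ?_⟩
        have hab := hG.mul_pow_mem a b
        rw [← QuotientGroup.eq] at ha hb hab ⊢
        rw [← hab, QuotientGroup.mk_mul, QuotientGroup.mk_mul, ha, hb]
      | inv x _ hx =>
        obtain ⟨a, ha⟩ := hx
        refine ⟨a⁻¹, ?_⟩
        rw [← QuotientGroup.eq] at ha ⊢
        rw [inv_pow, QuotientGroup.mk_inv, QuotientGroup.mk_inv, ha]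
    set H : Subgroup G := Subgroup.zpowers a ⊔ powerSeriesSubgroup G p 1
    have hgH : g ∈ sgPow H p := by
      rw [← mul_inv_cancel_left (a ^ p) g]
      exact mul_mem (pow_mem_sgPow (Subgroup.mem_sup_left (Subgroup.mem_zpowers a)) p)
        (sgPow_mono le_sup_right p ha)
    by_cases htop : H = ⊤
    · have hcomm := hG.commute_of_zpowers_sup_eq_top htop
      clear ha hgH
      induction hg using Subgroup.closure_induction with
      | mem x hx =>
        obtain ⟨a, -, rfl⟩ := hx
        exact ⟨a, rfl⟩
      | one => exact ⟨1, one_pow p⟩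
      | mul x y _ _ hx hy =>
        obtain ⟨a, rfl⟩ := hx
        obtain ⟨b, rfl⟩ := hy
        exact ⟨a * b, (hcomm a b).mul_pow p⟩
      | inv x _ hx =>
        obtain ⟨a, rfl⟩ := hx
        exact ⟨a⁻¹, inv_pow a p⟩
    · have hlt : Nat.card H < Nat.card G :=
        lt_of_le_of_ne (Subgroup.card_le_card_group H) (mt (Subgroup.eq_top_of_card_eq H) htop)
      have hmap : sgPow H p = (sgPow (⊤ : Subgroup H) p).map H.subtype := by
        rw [map_sgPow, ← MonoidHom.range_eq_map, Subgroup.range_subtype]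
      rw [hmap] at hgH
      obtain ⟨g', hg', rfl⟩ := hgH
      obtain ⟨x, rfl⟩ := ih H (hG.zpowers_sup_powerSeriesSubgroup_one a) (by omega) g' hg'
      exact ⟨x, rfl⟩

/-- Every element of `P (k + 1)` is the `p`-th power of an element of `P k`. -/
theorem exists_pow_eq (hG : IsPowerfulPGroup p G) {k : ℕ} {g : G} (hg : g ∈ P (k + 1)) :
    ∃ x ∈ P k, x ^ p = g := by
  have hmap : P (k + 1) = (sgPow (⊤ : Subgroup (P k)) p).map (P k).subtype := by
    rw [map_sgPow, ← MonoidHom.range_eq_map, Subgroup.range_subtype]; rfl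
  rw [hmap] at hg
  obtain ⟨g', hg', rfl⟩ := hg
  obtain ⟨x, rfl⟩ :=
    exists_pow_eq_of_card_le _ (P k) (hG.powerSeriesSubgroup_subgroup k) le_rfl g' hg'
  exact ⟨x, x.2, rfl⟩

theorem exists_pow_pow_eq (hG : IsPowerfulPGroup p G) {k : ℕ} {g : G} (hg : g ∈ P k) :
    ∃ x, x ^ p ^ k = g := by
  induction k generalizing g with
  | zero => exact ⟨g, by simp⟩
  | succ k ih =>
    obtain ⟨y, hy, rfl⟩ := hG.exists_pow_eq hg
    obtain ⟨x, rfl⟩ := ih hy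
    exact ⟨x, by rw [pow_succ, pow_mul]⟩

theorem powerSeriesSubgroup_eq_sgPow (hG : IsPowerfulPGroup p G) (k : ℕ) :
    P k = sgPow ⊤ (p ^ k) := by
  refine le_antisymm (fun g hg => ?_)
    (sgPow_le_iff.mpr fun x _ => pow_pow_mem_powerSeriesSubgroup p k x)
  obtain ⟨x, rfl⟩ := hG.exists_pow_pow_eq hg
  exact pow_mem_sgPow (Subgroup.mem_top x) _

theorem exists_powerSeriesSubgroup_eq_bot (hG : IsPowerfulPGroup p G) : ∃ k, P k = ⊥ := by
  have : Fact p.Prime := ⟨hG.prime⟩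
  obtain ⟨k, hk⟩ := IsPGroup.iff_card.mp hG.isPGroup
  refine ⟨k, (Subgroup.eq_bot_iff_forall _).mpr fun g hg => ?_⟩
  obtain ⟨x, rfl⟩ := hG.exists_pow_pow_eq hg
  rw [← hk, pow_card_eq_one']

theorem commute_and_mul_pow_eq_one_of_card_le.{u} (n : ℕ) : ∀ (G : Type u) [Group G] [Finite G],
    IsPowerfulPGroup p G → Nat.card G ≤ n →
      (∀ k, ∀ u ∈ powerSeriesSubgroup G p k, ∀ y : G, u ^ p = 1 → y ^ p ^ k = 1 → Commute u y) ∧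
      ∀ x y : G, x ^ p = 1 → y ^ p = 1 → (x * y) ^ p = 1 := by
  induction n with
  | zero => exact fun G _ _ _ h => absurd h Nat.card_pos.not_ge
  | succ n ih =>
    intro G _ _ hG hcard
    have htorsion (a : G) (ha : Subgroup.zpowers a ⊔ powerSeriesSubgroup G p 1 ≠ ⊤) :
        ∃ A : Subgroup G, A.Normal ∧
          ∀ g, g ∈ A ↔ g ∈ Subgroup.zpowers a ⊔ powerSeriesSubgroup G p 1 ∧ g ^ p = 1 := by
      refine exists_normal_torsion (hG.zpowers_sup_powerSeriesSubgroup_one_normal a)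
        (ih _ (hG.zpowers_sup_powerSeriesSubgroup_one a) ?_).2
      have := lt_of_le_of_ne (Subgroup.card_le_card_group _) (mt (Subgroup.eq_top_of_card_eq _) ha)
      omega
    obtain ⟨K, hK⟩ := hG.exists_powerSeriesSubgroup_eq_bot
    have hD (m : ℕ) : ∀ k, K ≤ k + m → ∀ u ∈ powerSeriesSubgroup G p k, ∀ y : G, u ^ p = 1 →
        y ^ p ^ k = 1 → Commute u y := by
      induction m with
      | zero =>
        intro k hk u hu y _ _
        have : u = 1 := by simpa [hK] using powerSeriesSubgroup_antitone p hk hu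
        exact this ▸ Commute.one_left y
      | succ m ihm =>
        rintro (_ | k) hk u hu y hup hyp
        · rw [pow_zero, pow_one] at hyp
          exact hyp ▸ Commute.one_right u
        replace ihm := ihm (k + 2) (by omega)
        rcases eq_or_ne y 1 with rfl | hy
        · exact Commute.one_right u
        by_cases htop : Subgroup.zpowers y ⊔ powerSeriesSubgroup G p 1 = ⊤
        · exact hG.commute_of_zpowers_sup_eq_top htop u y
        obtain ⟨A, hA, hmem⟩ := htorsion y htop
        have hP (j : ℕ) : powerSeriesSubgroup G p (j + 1) ≤
            Subgroup.zpowers y ⊔ powerSeriesSubgroup G p 1 :=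
          (powerSeriesSubgroup_antitone p (Nat.le_add_left 1 j)).trans le_sup_right
        have hp : Fact p.Prime := ⟨hG.prime⟩
        have hne : A ≠ ⊥ := by
          obtain ⟨⟨z, hz⟩, hz'⟩ := exists_prime_orderOf_dvd_card' (G := Subgroup.zpowers y) p
            (by rw [Nat.card_zpowers]; exact hG.isPGroup.dvd_orderOf hy)
          rw [Subgroup.orderOf_mk] at hz'
          refine (Subgroup.ne_bot_iff_exists_ne_one).mpr
            ⟨⟨z, (hmem z).mpr ⟨Subgroup.mem_sup_left hz, hz' ▸ pow_orderOf_eq_one z⟩⟩, fun h => ?_⟩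
          rw [Subgroup.mk_eq_one] at h
          rw [h, orderOf_one] at hz'
          exact hG.prime.one_lt.ne hz'
        have hlt : Nat.card (G ⧸ A) < Nat.card G := by
          rw [Subgroup.card_eq_card_quotient_mul_card_subgroup A]
          exact lt_mul_of_one_lt_right Nat.card_pos ((Subgroup.one_lt_card_iff_ne_bot A).mpr hne)
        obtain ⟨v, hv, rfl⟩ := hG.exists_pow_eq hu
        have hf : ⁅v, y⁆ ∈ A := by
          rw [← QuotientGroup.commute_mk_iff]
          refine (ih (G ⧸ A) (hG.of_surjective (QuotientGroup.mk'_surjective A)) (by omega)).1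
            k _ ?_ _ ?_ ?_
          · rw [← map_powerSeriesSubgroup (QuotientGroup.mk'_surjective A)]
            exact Subgroup.mem_map_of_mem _ hv
          · exact (QuotientGroup.eq_one_iff (v ^ p)).mpr ((hmem _).mpr ⟨hP k hu, hup⟩)
          · refine (QuotientGroup.eq_one_iff (y ^ p ^ k)).mpr ((hmem _).mpr ⟨?_, ?_⟩)
            · exact Subgroup.mem_sup_left (pow_mem (Subgroup.mem_zpowers y) _)
            · rw [← pow_mul, ← pow_succ, hyp]
        have hfP := hG.commutatorElement_mem_left hv y
        have hf₂ : ⁅v, ⁅v, y⁆⁆ ∈ A :=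
          Subgroup.commutator_le_right ⊤ A
            (Subgroup.commutator_mem_commutator (Subgroup.mem_top v) hf)
        have hf₂P := hG.commutatorElement_mem_right hfP v
        have hf' := ((hmem _).mp hf).2
        have hf₂' := ((hmem _).mp hf₂).2
        have h₁ : Commute ⁅v, ⁅v, y⁆⁆ ⁅v, y⁆ := by
          refine ihm _ hf₂P _ hf₂' ?_
          rw [pow_succ', pow_mul, hf', one_pow]
        have h₂ : Commute ⁅v, ⁅v, y⁆⁆ v := by
          refine ihm _ hf₂P _ hf₂' ?_
          rw [pow_succ', pow_succ', pow_mul, pow_mul, hup, one_pow]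
        rw [← commutatorElement_eq_one_iff_commute, commutatorElement_pow_left_of_commute h₁ h₂,
          pow_choose_two_eq_one hG.odd hf₂', hf', one_mul]
    replace hD := hD K
    refine ⟨fun k => hD k (Nat.le_add_left K k), fun x y hx hy => ?_⟩
    by_cases htop : Subgroup.zpowers x ⊔ powerSeriesSubgroup G p 1 = ⊤
    · rw [(hG.commute_of_zpowers_sup_eq_top htop x y).mul_pow, hx, hy, one_mul]
    obtain ⟨A, hA, hmem⟩ := htorsion x htop
    have hc : ⁅y, x⁆ ∈ A :=
      Subgroup.commutator_le_right ⊤ A (Subgroup.commutator_mem_commutator (Subgroup.mem_top y)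
        ((hmem x).mpr ⟨Subgroup.mem_sup_left (Subgroup.mem_zpowers x), hx⟩))
    have hc' := ((hmem _).mp hc).2
    have hcP : ⁅y, x⁆ ∈ powerSeriesSubgroup G p 1 :=
      hG.commutatorElement_mem_left (k := 0) (Subgroup.mem_top y) x
    have hD₁ := hD 1 (Nat.le_add_left K 1) _ hcP
    rw [mul_pow_of_commute_commutatorElement (hD₁ x hc' (by rwa [pow_one]))
      (hD₁ y hc' (by rwa [pow_one])), hx, hy, pow_choose_two_eq_one hG.odd hc', one_mul, one_mul]

theorem mul_pow_eq_one (hG : IsPowerfulPGroup p G) {x y : G} (hx : x ^ p = 1) (hy : y ^ p = 1) :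
    (x * y) ^ p = 1 :=
  (commute_and_mul_pow_eq_one_of_card_le _ G hG le_rfl).2 x y hx hy

theorem commute_of_pow_eq_one (hG : IsPowerfulPGroup p G) {u x : G} (hu : u ∈ P 1)
    (hup : u ^ p = 1) (hx : x ^ p = 1) : Commute u x :=
  (commute_and_mul_pow_eq_one_of_card_le _ G hG le_rfl).1 1 u hu x hup (by rwa [pow_one])

theorem exists_normal_preimage_pow (hG : IsPowerfulPGroup p G) (N : Subgroup G) [N.Normal] :
    ∃ T : Subgroup G, T.Normal ∧ ∀ x, x ∈ T ↔ x ^ p ∈ N := by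
  obtain ⟨A, hA, hmem⟩ := exists_normal_torsion (p := p) (H := (⊤ : Subgroup (G ⧸ N)))
    inferInstance fun x y hx hy => (hG.of_surjective
      (f := Subgroup.topEquiv.symm.toMonoidHom.comp (QuotientGroup.mk' N))
      (Subgroup.topEquiv.symm.surjective.comp (QuotientGroup.mk'_surjective N))).mul_pow_eq_one
        hx hy
  refine ⟨A.comap (QuotientGroup.mk' N), inferInstance, fun x => ?_⟩
  rw [Subgroup.mem_comap, hmem]
  exact (and_iff_right (Subgroup.mem_top _)).trans (QuotientGroup.eq_one_iff (x ^ p))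

theorem commutatorElement_mem_of_pow_mem (hG : IsPowerfulPGroup p G) {N : Subgroup G} [N.Normal]
    {u x : G} (hu : u ∈ P 1) (hup : u ^ p ∈ N) (hx : x ^ p ∈ N) : ⁅u, x⁆ ∈ N := by
  rw [← QuotientGroup.commute_mk_iff]
  refine (hG.of_surjective (QuotientGroup.mk'_surjective N)).commute_of_pow_eq_one ?_
    ((QuotientGroup.eq_one_iff (u ^ p)).mpr hup) ((QuotientGroup.eq_one_iff (x ^ p)).mpr hx)
  rw [← map_powerSeriesSubgroup (QuotientGroup.mk'_surjective N)]
  exact Subgroup.mem_map_of_mem _ hu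

theorem commutatorElement_mem_centralizerMod (hG : IsPowerfulPGroup p G) {N T : Subgroup G}
    [N.Normal] [T.Normal] (hT : ∀ x, x ∈ T ↔ x ^ p ∈ N) (j : ℕ) :
    ∀ n ∈ N ⊓ P (j + 1), ∀ x ∈ T, ⁅n, x⁆ ∈ centralizerMod (sgPow (N ⊓ P (j + 2)) p) T := by
  obtain ⟨K, hK⟩ := hG.exists_powerSeriesSubgroup_eq_bot
  suffices ∀ m j, K ≤ j + m → ∀ n ∈ N ⊓ P (j + 1), ∀ x ∈ T,
      ⁅n, x⁆ ∈ centralizerMod (sgPow (N ⊓ P (j + 2)) p) T from this K j (Nat.le_add_left K j)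
  clear j
  intro m
  induction m with
  | zero =>
    intro j hj n hn x _
    have : n = 1 := by
      simpa [hK] using powerSeriesSubgroup_antitone p (hj.trans (Nat.le_succ j)) hn.2
    rw [this, commutatorElement_one_left]
    exact one_mem _
  | succ m ih =>
    intro j hj n hn x hx
    set R := sgPow (N ⊓ P (j + 2)) p
    have hRT : R ≤ centralizerMod R T := fun r hr => mem_centralizerMod.mpr fun t _ =>
      Subgroup.commutator_le_left R ⊤ (Subgroup.commutator_mem_commutator hr (Subgroup.mem_top t))
    have hNT : N ≤ T := fun a ha => (hT a).mpr (pow_mem ha p)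
    have hIH : ∀ n ∈ N ⊓ P (j + 2), ∀ x ∈ T, ∀ t ∈ T, ⁅⁅n, x⁆, t⁆ ∈ R := fun n hn x hx t ht =>
      sgPow_mono (inf_le_inf_left N (powerSeriesSubgroup_antitone p (Nat.le_succ (j + 2)))) p
        (mem_centralizerMod.mp (ih (j + 1) (by omega) n hn x hx) t ht)
    obtain ⟨y, hyP, rfl⟩ := hG.exists_pow_eq hn.2
    have hyT : y ∈ T := (hT y).mpr hn.1
    set f := ⁅y, x⁆
    have hfT : f ∈ T :=
      Subgroup.commutator_le_left T ⊤ (Subgroup.commutator_mem_commutator hyT (Subgroup.mem_top x))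
    have hfP : f ∈ P (j + 1) := hG.commutatorElement_mem_left hyP x
    have hfP₁ : f ∈ P 1 := powerSeriesSubgroup_antitone p (Nat.le_add_left 1 j) hfP
    have hfN {z : G} (hz : z ∈ T) : ⁅f, z⁆ ∈ N ⊓ P (j + 2) :=
      ⟨hG.commutatorElement_mem_of_pow_mem hfP₁ ((hT f).mp hfT) ((hT z).mp hz),
        hG.commutatorElement_mem_left hfP z⟩
    have hg : ⁅y, f⁆ ∈ N ⊓ P (j + 2) := by
      rw [← commutatorElement_inv]
      exact inv_mem (hfN hyT)
    have hfp : f ^ p ∈ centralizerMod R T := by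
      refine mem_centralizerMod.mpr fun z hz => ?_
      have hk := hfN hz
      have hd := hfN (hNT hk.1)
      have hdS : ∀ t ∈ T, ⁅⁅f, ⁅f, z⁆⁆, t⁆ ∈ R := by
        refine mem_centralizerMod.mp ?_
        rw [← commutatorElement_inv]
        exact inv_mem (mem_centralizerMod.mpr (hIH _ hk f hfT))
      exact commutatorElement_pow_left_mem hG.odd (hdS _ (hNT hk.1)) (hdS f hfT)
        (pow_mem_sgPow hd p) (pow_mem_sgPow hk p)
    rw [← Subgroup.mul_mem_cancel_right _ (inv_mem hfp)]
    exact commutatorElement_pow_left_mul_inv_mem hG.odd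
      (mem_centralizerMod.mpr (hIH _ hg f hfT)) (mem_centralizerMod.mpr (hIH _ hg y hyT))
      (hRT (pow_mem_sgPow hg p))

theorem commutator_inf_le_sgPow (hG : IsPowerfulPGroup p G) {N : Subgroup G} [N.Normal]
    (hN : N ≤ P 1) (i : ℕ) : ⁅N ⊓ P (i + 1), N⁆ ≤ sgPow (N ⊓ P (i + 2)) p := by
  obtain ⟨T, hTn, hT⟩ := hG.exists_normal_preimage_pow N
  have hNT : N ≤ T := fun a ha => (hT a).mpr (pow_mem ha p)
  rw [Subgroup.commutator_comm, Subgroup.commutator_le]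
  intro m hm n hn
  obtain ⟨y, -, rfl⟩ := hG.exists_pow_eq (hN hm)
  have hyT : y ∈ T := (hT y).mpr hm
  have hmem {a : G} {j : ℕ} (ha : a ∈ N ⊓ P j) : ⁅y, a⁆ ∈ N ⊓ P (j + 1) :=
    ⟨Subgroup.commutator_le_right ⊤ N
      (Subgroup.commutator_mem_commutator (Subgroup.mem_top y) ha.1),
      hG.commutatorElement_mem_right ha.2 y⟩
  have he := hmem hn
  have hd := inf_le_inf_left N (powerSeriesSubgroup_antitone p (Nat.le_succ (i + 2))) (hmem he)
  have hdS : ∀ t ∈ T, ⁅⁅y, ⁅y, n⁆⁆, t⁆ ∈ sgPow (N ⊓ P (i + 2)) p := by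
    refine mem_centralizerMod.mp ?_
    rw [← commutatorElement_inv]
    exact inv_mem (mem_centralizerMod.mpr fun t ht =>
      sgPow_mono (inf_le_inf_left N (powerSeriesSubgroup_antitone p (Nat.le_succ (i + 2)))) p
        (mem_centralizerMod.mp (hG.commutatorElement_mem_centralizerMod hT (i + 1) _ he y hyT) t ht))
  exact commutatorElement_pow_left_mem hG.odd (hdS _ (hNT he.1)) (hdS y hyT)
    (pow_mem_sgPow hd p) (pow_mem_sgPow he p)

/-- A normal subgroup of a powerful group `G` which is contained in `G^p` is powerfully
nilpotent. -/
theorem powerfullyNilpotentOn (hG : IsPowerfulPGroup p G) {N : Subgroup G} [N.Normal]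
    (hN : N ≤ P 1) : PowerfullyNilpotentOn p N := by
  obtain ⟨K, hK⟩ := hG.exists_powerSeriesSubgroup_eq_bot
  refine ⟨K, fun m => N ⊓ P (K + 1 - m), ?_, ?_, fun m => ?_, fun m => inf_le_left,
    fun m hm => ?_⟩
  · rw [← le_bot_iff, ← hK]
    exact inf_le_right.trans (powerSeriesSubgroup_antitone p (Nat.le_succ K))
  · simpa using hN
  · exact inf_le_inf_left N (powerSeriesSubgroup_antitone p (by omega))
  · obtain ⟨i, rfl⟩ := Nat.exists_eq_add_of_lt hm
    have h₁ : m + i + 1 + 1 - (m + 1) = i + 1 := by omega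
    have h₂ : m + i + 1 + 1 - m = i + 2 := by omega
    simp only [h₁, h₂]
    exact hG.commutator_inf_le_sgPow hN i

end IsPowerfulPGroup

theorem PowerfullyNilpotentOn.map {G G' : Type*} [Group G] [Group G'] {p : ℕ} {N : Subgroup G}
    (hN : PowerfullyNilpotentOn p N) (f : G →* G') : PowerfullyNilpotentOn p (N.map f) := by
  obtain ⟨n, H, h₀, hn, hmono, hle, hcomm⟩ := hN
  refine ⟨n, fun i => (H i).map f, by simp [h₀], by simp [hn],
    fun i => Subgroup.map_mono (hmono i), fun i => Subgroup.map_mono (hle i), fun i hi => ?_⟩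
  rw [← Subgroup.map_commutator, ← map_sgPow]
  exact Subgroup.map_mono (hcomm i hi)

end Powerful

/-- if G is a powerful p-group (p odd), i ∈ ℕ, and N is a subgroup that is
normal in G^{p^i} and contained in G^{p^{i+1}}, then N is powerfully nilpotent. -/
theorem stmt10 {G : Type*} [Group G] [Finite G] (p : ℕ) (hp : p.Prime) (hodd : Odd p)
    (hpG : IsPGroup p G)
    (hpowerful : ⁅(⊤ : Subgroup G), (⊤ : Subgroup G)⁆ ≤ sgPow ⊤ p)
    (i : ℕ) (N : Subgroup G)
    (hNle : N ≤ sgPow (⊤ : Subgroup G) (p ^ (i + 1)))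
    (hNnormal : ∀ g ∈ sgPow (⊤ : Subgroup G) (p ^ i), ∀ n ∈ N, g * n * g⁻¹ ∈ N) :
    PowerfullyNilpotentOn p N := by
  have hG : IsPowerfulPGroup p G := ⟨hp, hodd, hpG, hpowerful⟩
  rw [← hG.powerSeriesSubgroup_eq_sgPow] at hNle hNnormal
  have hle : N ≤ powerSeriesSubgroup G p i :=
    hNle.trans (powerSeriesSubgroup_antitone p (Nat.le_succ i))
  have hnormal : (N.subgroupOf (powerSeriesSubgroup G p i)).Normal :=
    ⟨fun n hn g => hNnormal g g.2 n hn⟩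
  rw [← Subgroup.map_subgroupOf_eq_of_le hle]
  refine ((hG.powerSeriesSubgroup_subgroup i).powerfullyNilpotentOn ?_).map _
  rw [← Subgroup.map_subtype_le_map_subtype, Subgroup.map_subgroupOf_eq_of_le hle]
  change N ≤ (sgPow ⊤ p).map _
  rwa [map_sgPow, ← MonoidHom.range_eq_map, Subgroup.range_subtype]
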